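/- Let p ≥ 5 be a prime and m ≥ 1 an integer. Then in ℤ[q], [p]_q^3 divides (q^{mp+1}; q)_{p−1} − q^{mp(p−1)/2} (q; q)_{p−1} − (m(m+1)(p^2−1)p/24)·(1−q)^2 [p]_q^2. -/

import Mathlib

open Polynomial Finset

/-- The q-integer [n]_q = 1 + q + ... + q^(n-1) in ℤ[q]. -/
noncomputable def qInt (n : ℕ) : Polynomial ℤ := ∑ i ∈ Finset.range n, X ^ i

/-- The q-shifted factorial (A; q)_n = (1-A)(1-Aq)⋯(1-Aq^(n-1)) with A = q^a, in ℤ[q]. -/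
noncomputable def qShifted (a n : ℕ) : Polynomial ℤ :=
  ∏ j ∈ Finset.range n, (1 - X ^ (a + j))

lemma aux_pow {R : Type*} [CommRing R] (Φ v y : R) (hy : y = 1 - v * Φ) (k : ℕ) :
    ∃ r, y ^ k = 1 - k * (v * Φ) + r * Φ ^ 2 := by
  induction k with
  | zero => exact ⟨0, by simp⟩
  | succ k ih =>
    obtain ⟨r, hr⟩ := ih
    refine ⟨r * y + k * v ^ 2, ?_⟩
    rw [pow_succ, hr]; subst hy; push_cast; ring

lemma aux_pow1 {R : Type*} [CommRing R] (Φ v y : R) (hy : y = 1 - v * Φ) (k : ℕ) :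
    ∃ r, y ^ k = 1 + r * Φ := by
  obtain ⟨r, hr⟩ := aux_pow Φ v y hy k
  exact ⟨-k * v + r * Φ, by rw [hr]; ring⟩

lemma aux_term {R : Type*} [CommRing R] (Φ v y a : R) (hy : y = 1 - v * Φ) (ha : Φ ∣ a - 1)
    (e k n : ℕ) :
    Φ ^ 3 ∣ a * y ^ e * (y ^ k - y ^ n) ^ 2 - (((k : ℤ) - n) ^ 2 : ℤ) * (v ^ 2 * Φ ^ 2) := by
  obtain ⟨r, hr⟩ := aux_pow Φ v y hy k
  obtain ⟨s, hs⟩ := aux_pow Φ v y hy n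
  obtain ⟨w, hw⟩ := aux_pow1 Φ v y hy e
  obtain ⟨b, hb⟩ := ha
  obtain rfl : a = 1 + Φ * b := by linear_combination hb
  rw [hr, hs, hw]
  have : (1 - (k:R) * (v * Φ) + r * Φ ^ 2 - (1 - n * (v * Φ) + s * Φ ^ 2)) ^ 2
    = Φ ^ 2 * (-(k - n) * v + (r - s) * Φ) ^ 2 := by ring
  rw [this]
  push_cast
  refine ⟨(b + w + Φ * b * w) * (-(k - n) * v + (r - s) * Φ) ^ 2
    - 2 * (k - n) * v * (r - s) + (r - s) ^ 2 * Φ, ?_⟩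
  ring

lemma sum_sq (n : ℕ) : ∑ k ∈ range (2 * n + 1), (((k : ℤ) - n) ^ 2) =
    2 * ((∑ i ∈ range (n + 1), i ^ 2 : ℕ) : ℤ) := by
  have h1 : ∀ n : ℕ, 3 * (∑ i ∈ range (n + 1), (i:ℤ) ^ 2) * 2 = n * (n + 1) * (2 * n + 1) := by
    intro n
    induction n with
    | zero => simp
    | succ n ih => rw [sum_range_succ, mul_add, add_mul, ih]; push_cast; ring
  have h2 : ∀ (N : ℕ) (c : ℤ), 6 * ∑ k ∈ range N, ((k : ℤ) - c) ^ 2 =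
      N * (N - 1) * (2 * N - 1) - 6 * c * N * (N - 1) + 6 * N * c ^ 2 := by
    intro N c
    induction N with
    | zero => simp
    | succ n ih => rw [sum_range_succ, mul_add, ih]; push_cast; ring
  have := h1 n
  have h3 := h2 (2 * n + 1) n
  push_cast at *
  linarith

lemma sum_id (p n m : ℕ) (hp : p = 2 * n + 1) :
    m * (m + 1) * (p ^ 2 - 1) * p / 24 = m * (m + 1) * ∑ i ∈ range (n + 1), i ^ 2 := by
  have h1 : ∀ n : ℕ, 6 * (∑ i ∈ range (n + 1), i ^ 2) = n * (n + 1) * (2 * n + 1) := by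
    intro n
    induction n with
    | zero => simp
    | succ n ih => rw [sum_range_succ, mul_add, ih]; ring
  apply Nat.div_eq_of_eq_mul_left (by norm_num)
  have : p ^ 2 - 1 = 4 * (n * (n + 1)) := by
    subst hp; rw [Nat.sub_eq_iff_eq_add (Nat.one_le_pow _ _ (by omega))]; ring
  rw [this, hp]
  have h2 : m * (m + 1) * (∑ i ∈ range (n + 1), i ^ 2) * 24
      = 4 * m * (m + 1) * (6 * ∑ i ∈ range (n + 1), i ^ 2) := by ring
  rw [h2, h1]; ring

lemma abstract_main {R : Type*} [CommRing R] (Φ v y : R) (hy : y = 1 - v * Φ) (n : ℕ)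
    (a : ℕ → R) (ha : ∀ k ∈ range (2 * n + 1), Φ ∣ a k - 1) (f : ℕ → R)
    (hf : ∀ m, f m = ∑ k ∈ range (2 * n + 1), a k * (y ^ m) ^ k)
    (hsym : ∑ k ∈ range (2 * n + 1), a k * y ^ (2 * n - k) = y ^ n * f 0) (m : ℕ) :
    Φ ^ 3 ∣ f m - y ^ (n * m) * f 0 -
      ((m * (m + 1) * (∑ i ∈ range (n + 1), i ^ 2) : ℕ) : R) * (v ^ 2 * Φ ^ 2) := by
  set s := ∑ i ∈ range (n + 1), i ^ 2 with hs
  have key : ∀ e : ℕ → ℕ, Φ ^ 3 ∣ ∑ k ∈ range (2 * n + 1), a k * y ^ (e k) * (y ^ k - y ^ n) ^ 2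
      - 2 * (s : R) * (v ^ 2 * Φ ^ 2) := by
    intro e
    have h := sum_sq n
    rw [← hs] at h
    have h' := congrArg (Int.cast : ℤ → R) h
    push_cast at h'
    rw [← h', sum_mul, ← sum_sub_distrib]
    apply dvd_sum
    intro k hk
    have := aux_term Φ v y (a k) hy (ha k hk) (e k) k n
    push_cast at this
    exact this
  have hrec : ∀ m, Φ ^ 3 ∣ f (m + 2) - 2 * y ^ n * f (m + 1) + y ^ (2 * n) * f m
      - 2 * (s : R) * (v ^ 2 * Φ ^ 2) := by
    intro m
    convert key (fun k => m * k) using 2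
    rw [hf, hf, hf, mul_sum, mul_sum, ← sum_sub_distrib, ← sum_add_distrib]
    apply sum_congr rfl
    intro k _
    simp only [← pow_mul]
    ring
  obtain ⟨w, hw⟩ := aux_pow1 Φ v y hy n
  have h1 : Φ ^ 3 ∣ f 1 - y ^ n * f 0 - 2 * (s : R) * (v ^ 2 * Φ ^ 2) := by
    have hco : IsCoprime (Φ ^ 3) (y ^ (2 * n)) := by
      apply IsCoprime.pow
      exact ⟨v, 1, by rw [hy]; ring⟩
    apply hco.dvd_of_dvd_mul_left
    have h0 : y ^ (2 * n) * f 1 - y ^ (2 * n) * (y ^ n * f 0)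
        = ∑ k ∈ range (2 * n + 1), a k * y ^ (2 * n - k) * (y ^ k - y ^ n) ^ 2 := by
      have : y ^ (2 * n) * f 1 - y ^ (2 * n) * (y ^ n * f 0) = y ^ (2 * n) * f 1 -
        2 * y ^ (3 * n) * f 0 + y ^ (2 * n) * (y ^ n * f 0) := by ring
      rw [this, ← hsym, hf, hf, mul_sum, mul_sum, mul_sum, ← sum_sub_distrib, ← sum_add_distrib]
      apply sum_congr rfl
      intro k hk
      have hk' : y ^ (2 * n) = y ^ (2 * n - k) * y ^ k := by
        rw [← pow_add]; congr 1; have := mem_range.1 hk; omega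
      have h3 : y ^ (3 * n) = y ^ n * (y ^ (2 * n - k) * y ^ k) := by rw [← hk']; ring
      rw [h3]
      have e2 : (y ^ n) ^ 2 = y ^ (2 * n) := by ring
      simp only [pow_zero, one_pow, pow_one, mul_one]
      linear_combination (a k * y ^ k) * hk' - a k * y ^ (2 * n - k) * e2
    obtain ⟨c, hc⟩ := key (fun k => 2 * n - k)
    obtain ⟨w2, hw2⟩ := aux_pow1 Φ v y hy (2 * n)
    refine ⟨c - 2 * s * v ^ 2 * w2, ?_⟩
    linear_combination h0 + hc - 2 * s * v ^ 2 * Φ ^ 2 * hw2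
  have : ∀ m, (Φ ^ 3 ∣ f m - y ^ (n * m) * f 0 -
      ((m * (m + 1) * s : ℕ) : R) * (v ^ 2 * Φ ^ 2)) ∧ (Φ ^ 3 ∣ f (m + 1) - y ^ (n * (m + 1)) * f 0 -
      (((m + 1) * (m + 1 + 1) * s : ℕ) : R) * (v ^ 2 * Φ ^ 2)) := by
    intro m
    induction m with
    | zero =>
      refine ⟨by simp, ?_⟩
      convert h1 using 2
      · simp
      · push_cast; ring
    | succ m ih =>
      refine ⟨ih.2, ?_⟩
      obtain ⟨⟨c, hc⟩, ⟨d, hd⟩⟩ := ih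
      obtain ⟨b, hb⟩ := hrec m
      obtain ⟨w2, hw2⟩ := aux_pow1 Φ v y hy (2 * n)
      push_cast at *
      refine ⟨b + 2 * y ^ n * d - y ^ (2 * n) * c + 2 * ((m + 1) * (m + 2) * s) * v ^ 2 * w
        - (m * (m + 1) * s) * v ^ 2 * w2, ?_⟩
      linear_combination hb + 2 * y ^ n * hd - y ^ (2 * n) * hc
       + 2 * ((m + 1) * (m + 2) * s) * v ^ 2 * Φ ^ 2 * hw - (m * (m + 1) * s) * v ^ 2 * Φ ^ 2 * hw2
  exact (this m).1

lemma prod_zeta (p : ℕ) (hp : 0 < p) (ζ : ℂ) (hζ : IsPrimitiveRoot ζ p) :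
    ∏ j ∈ range (p - 1), (1 - C (ζ ^ (1 + j)) * X : ℂ[X]) = ∑ k ∈ range p, X ^ k := by
  have h := X_pow_sub_one_eq_prod hp hζ
  have hζ' : IsPrimitiveRoot (C ζ : ℂ[X]) p := hζ.map_of_injective C_injective
  have h := hζ'.pow_sub_pow_eq_prod_sub_mul 1 X hp
  have himg : nthRootsFinset p (1 : ℂ[X]) = (range p).image (fun j => (C ζ) ^ j) := by
    symm
    apply eq_of_subset_of_card_le
    · intro x hx
      obtain ⟨j, _, rfl⟩ := mem_image.1 hx
      rw [mem_nthRootsFinset hp, ← pow_mul, mul_comm, pow_mul, hζ'.pow_eq_one, one_pow]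
    · rw [hζ'.card_nthRootsFinset, card_image_of_injOn, card_range]
      intro i hi j hj hij
      exact hζ'.pow_inj (by simpa using hi) (by simpa using hj) hij
  rw [himg, prod_image] at h
  swap
  · intro i hi j hj hij
    exact hζ'.pow_inj (by simpa using hi) (by simpa using hj) hij
  obtain ⟨r, rfl⟩ : ∃ r, p = r + 1 := ⟨p - 1, by omega⟩
  rw [prod_range_succ'] at h
  have hg := mul_neg_geom_sum (X : ℂ[X]) (r + 1)
  have hne : (1 - X : ℂ[X]) ≠ 0 := sub_ne_zero.2 (by simpa using (X_ne_C (1:ℂ)).symm)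
  apply mul_left_cancel₀ hne
  rw [hg]
  simp only [one_pow, pow_zero, one_mul] at h
  rw [h, mul_comm]
  simp [add_comm]

lemma coeff_dvd (p : ℕ) (hp : p.Prime) (k : ℕ) (hk : k < p) :
    qInt p ∣ (∏ j ∈ range (p - 1), (1 - C (X ^ (1 + j)) * X : ℤ[X][X])).coeff k - 1 := by
  have hζ := Complex.isPrimitiveRoot_exp p hp.ne_zero
  set ζ := Complex.exp (2 * Real.pi * Complex.I / p)
  have := Fact.mk hp
  have hq : qInt p = minpoly ℤ ζ := by
    rw [← cyclotomic_eq_minpoly hζ hp.pos, cyclotomic_prime]; rfl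
  rw [hq]
  apply minpoly.isIntegrallyClosed_dvd (hζ.isIntegral hp.pos)
  have h := congrArg (fun P => coeff P k) (prod_zeta p hp.pos ζ hζ)
  have h2 : ∏ j ∈ range (p - 1), (1 - C (ζ ^ (1 + j)) * X : ℂ[X]) =
      (∏ j ∈ range (p - 1), (1 - C (X ^ (1 + j)) * X : ℤ[X][X])).map
        (aeval ζ : ℤ[X] →ₐ[ℤ] ℂ).toRingHom := by
    simp [Polynomial.map_prod]
  simp only [h2, coeff_map, finsetSum_coeff, coeff_X_pow] at h
  rw [sum_ite_eq, if_pos (mem_range.2 hk)] at h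
  rw [map_sub, map_one]
  exact sub_eq_zero.2 h

theorem perfect_q_analogue (p m : ℕ) (hp : p.Prime) (hp5 : 5 ≤ p) (hm : 1 ≤ m) :
    qInt p ^ 3 ∣
      qShifted (m * p + 1) (p - 1) - X ^ (m * p * (p - 1) / 2) * qShifted 1 (p - 1) -
        ((m * (m + 1) * (p ^ 2 - 1) * p / 24 : ℕ) : Polynomial ℤ) * (1 - X) ^ 2 * qInt p ^ 2 := by
  obtain ⟨n, hn⟩ : ∃ n, p = 2 * n + 1 := hp.odd_of_ne_two (by omega)
  rw [sum_id p n m hn]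
  set F : ℤ[X][X] := ∏ j ∈ range (p - 1), (1 - C (X ^ (1 + j)) * X : ℤ[X][X]) with hF
  have hdeg : F.natDegree < 2 * n + 1 := by
    have h : F.natDegree ≤ ∑ j ∈ range (p - 1), 1 := by
      refine (natDegree_prod_le _ _).trans (sum_le_sum fun j _ => ?_)
      compute_degree
    simp at h
    omega
  have hev : ∀ m, F.eval ((X ^ p) ^ m) = qShifted (m * p + 1) (p - 1) := by
    intro m
    rw [hF, eval_prod, qShifted]
    apply prod_congr rfl
    intro j _
    simp only [eval_sub, eval_one, eval_mul, eval_C, eval_X]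
    ring
  have hy : (X ^ p : ℤ[X]) = 1 - (1 - X) * qInt p := by
    rw [qInt, mul_neg_geom_sum]; ring
  have hsumj : ∑ j ∈ range (2 * n), (1 + j) = n * p := by
    have := Finset.sum_range_id_mul_two (2 * n + 1)
    rw [sum_range_succ'] at this
    simp only [add_comm 1]
    simp at this
    rw [hn]
    nlinarith
  have hsym : ∑ k ∈ range (2 * n + 1), F.coeff k * (X ^ p) ^ (2 * n - k) =
      (X ^ p) ^ n * qShifted (0 * p + 1) (p - 1) := by
    have h1 : (F.reflect (2 * n)).eval (X ^ p) =
        ∑ k ∈ range (2 * n + 1), F.coeff k * (X ^ p) ^ (2 * n - k) := by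
      have hd : (F.reflect (2 * n)).natDegree < 2 * n + 1 := by
        have := F.natDegree_reflect_le (N := 2 * n)
        omega
      rw [eval_eq_sum_range' hd, ← sum_range_reflect]
      apply sum_congr rfl
      intro k hk
      have := mem_range.1 hk
      rw [coeff_reflect, revAt_le (by omega)]
      congr 2
      · omega
    have h2 : ∀ N, (∏ j ∈ range N, (1 - C (X ^ (1 + j)) * X : ℤ[X][X])).reflect N
        = ∏ j ∈ range N, (X - C (X ^ (1 + j))) := by
      intro N
      induction N with
      | zero => simp
      | succ N ih =>
        rw [prod_range_succ, prod_range_succ, reflect_mul, ih]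
        · congr 1
          have e : (1 - C (X ^ (1 + N)) * X : ℤ[X][X]) = C 1 + C (-X ^ (1 + N)) * X ^ 1 := by
            rw [C_neg, C_1]; ring
          rw [e, reflect_add, reflect_C, reflect_C_mul_X_pow, revAt_le le_rfl]
          simp [sub_eq_add_neg]
        · refine (natDegree_prod_le _ _).trans ?_
          refine (sum_le_sum (g := fun _ => 1) fun j _ => ?_).trans (by simp)
          compute_degree
        · compute_degree
    have hp1 : p - 1 = 2 * n := by omega
    rw [← h1, hF, hp1, h2, eval_prod, qShifted, ← pow_mul, mul_comm p n, ← hsumj,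
      ← prod_pow_eq_pow_sum]
    rw [← prod_range_reflect (fun j => 1 - X ^ (0 * p + 1 + j)), ← prod_mul_distrib]
    have : ∀ j ∈ range (2 * n), eval (X ^ p) (X - C (X ^ (1 + j)) : ℤ[X][X]) =
       (-1) * (X ^ (1 + j) * (1 - X ^ (0 * p + 1 + (2 * n - 1 - j)))) := by
      intro j hj
      have := mem_range.1 hj
      rw [mul_sub, ← pow_add, show 1 + j + (0 * p + 1 + (2 * n - 1 - j)) = p by omega]
      simp
    rw [prod_congr rfl this, prod_mul_distrib]
    simp
  have := abstract_main (qInt p) (1 - X) (X ^ p) hy n F.coeff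
    (fun k hk => coeff_dvd p hp k (by rw [hn]; exact mem_range.1 hk))
    (fun m => qShifted (m * p + 1) (p - 1))
    (fun m => by rw [← hev, eval_eq_sum_range' hdeg]) hsym m
  convert this using 2
  · congr 2
    · rw [← pow_mul]
      congr 1
      rw [show p - 1 = n * 2 by omega, ← mul_assoc, Nat.mul_div_cancel _ (by norm_num)]
      ring
    · simp
  · ring
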